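/- Let (X,T) be a nonautonomous dynamical system and K ⊂ X_0 a non-empty compact set. Then the packing topological entropy satisfies h^P(T,K) = sup{ h̄_μ(T) : μ is a Borel probability measure on X_0 with μ(K) = 1 }. -/

import Mathlib

open Filter MeasureTheory Set
open scoped ENNReal Topology

namespace NDS

variable {X : ℕ → Type*}

/-- Iterates `T^j : X 0 → X j` of a nonautonomous dynamical system `T`. -/
def iter (T : ∀ k, X k → X (k + 1)) : ∀ j, X 0 → X j
  | 0 => fun x => x
  | j + 1 => fun x => T j (iter T j x)

/-- The Birkhoff-type sum `S_n^T f (x) = ∑_{j<n} f_j (T^j x)`. -/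
def birk (T : ∀ k, X k → X (k + 1)) (f : ∀ k, X k → ℝ) (n : ℕ) (x : X 0) : ℝ :=
  ∑ j ∈ Finset.range n, f j (iter T j x)

/-- The uniform norm `‖f‖ = sup_k sup_x |f_k x|` of a sequence of potentials. -/
noncomputable def fnorm (f : ∀ k, X k → ℝ) : ℝ :=
  ⨆ k : ℕ, ⨆ x : X k, |f k x|

/-- `log : ℝ≥0∞ → EReal` with the conventions `log 0 = -∞`, `log ∞ = ∞`. -/
noncomputable def elog (x : ℝ≥0∞) : EReal :=
  if x = 0 then ⊥ else if x = ⊤ then ⊤ else ((Real.log x.toReal : ℝ) : EReal)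

/-- The nonnegative part of an extended real, as an element of `ℝ≥0∞`. -/
noncomputable def toENN (x : EReal) : ℝ≥0∞ :=
  if x = ⊤ then ⊤ else ENNReal.ofReal x.toReal

/-- The canonical map `ℝ≥0∞ → EReal`. -/
noncomputable def ofENN (x : ℝ≥0∞) : EReal :=
  if x = ⊤ then ⊤ else ((x.toReal : ℝ) : EReal)

/-- The integral of an extended-real-valued function: the difference of the lower
integrals of its positive and negative parts. -/
noncomputable def eInt {α : Type*} [MeasurableSpace α] (μ : Measure α) (g : α → EReal) : EReal :=
  ofENN (∫⁻ x, toENN (g x) ∂μ) - ofENN (∫⁻ x, toENN (-g x) ∂μ)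

section Metric

variable [∀ k, MetricSpace (X k)]

/-- The open Bowen ball `B_n^T(x,ε)`. -/
def bowenBall (T : ∀ k, X k → X (k + 1)) (n : ℕ) (ε : ℝ) (x : X 0) : Set (X 0) :=
  {y | ∀ j < n, dist (iter T j x) (iter T j y) < ε}

/-- The closed Bowen ball `B̄_n^T(x,ε)`. -/
def bowenClosedBall (T : ∀ k, X k → X (k + 1)) (n : ℕ) (ε : ℝ) (x : X 0) : Set (X 0) :=
  {y | ∀ j < n, dist (iter T j x) (iter T j y) ≤ ε}

/-- Equicontinuity of a sequence of potentials `f = (f_k)`. -/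
def EquicontPotential (f : ∀ k, X k → ℝ) : Prop :=
  ∀ ε : ℝ, 0 < ε → ∃ δ : ℝ, 0 < δ ∧ ∀ k, ∀ x y : X k, dist x y < δ → |f k x - f k y| < ε

/-- The supremum of the Birkhoff sum `S_n^T f` over a subset `A` of `X 0`. -/
noncomputable def supBirk (T : ∀ k, X k → X (k + 1)) (f : ∀ k, X k → ℝ) (n : ℕ)
    (A : Set (X 0)) : ℝ :=
  ⨆ y : A, birk T f n (y : X 0)

/-- Measure-theoretic lower local pressure `P̲_μ(T,f,x)`. -/
noncomputable def localLowerPres [MeasurableSpace (X 0)] (μ : Measure (X 0))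
    (T : ∀ k, X k → X (k + 1)) (f : ∀ k, X k → ℝ) (x : X 0) : EReal :=
  ⨆ (ε : ℝ) (_ : 0 < ε),
    liminf (fun n : ℕ =>
      (((n : ℝ)⁻¹ : ℝ) : EReal) *
        (-(elog (μ (bowenBall T n ε x))) + ((birk T f n x : ℝ) : EReal))) atTop

/-- Measure-theoretic upper local pressure `P̄_μ(T,f,x)`. -/
noncomputable def localUpperPres [MeasurableSpace (X 0)] (μ : Measure (X 0))
    (T : ∀ k, X k → X (k + 1)) (f : ∀ k, X k → ℝ) (x : X 0) : EReal :=
  ⨆ (ε : ℝ) (_ : 0 < ε),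
    limsup (fun n : ℕ =>
      (((n : ℝ)⁻¹ : ℝ) : EReal) *
        (-(elog (μ (bowenBall T n ε x))) + ((birk T f n x : ℝ) : EReal))) atTop

/-- Measure-theoretic lower local entropy `h̲_μ(T,x)`. -/
noncomputable def localLowerEnt [MeasurableSpace (X 0)] (μ : Measure (X 0))
    (T : ∀ k, X k → X (k + 1)) (x : X 0) : EReal :=
  ⨆ (ε : ℝ) (_ : 0 < ε),
    liminf (fun n : ℕ =>
      (((n : ℝ)⁻¹ : ℝ) : EReal) * (-(elog (μ (bowenBall T n ε x))))) atTop

/-- Measure-theoretic upper local entropy `h̄_μ(T,x)`. -/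
noncomputable def localUpperEnt [MeasurableSpace (X 0)] (μ : Measure (X 0))
    (T : ∀ k, X k → X (k + 1)) (x : X 0) : EReal :=
  ⨆ (ε : ℝ) (_ : 0 < ε),
    limsup (fun n : ℕ =>
      (((n : ℝ)⁻¹ : ℝ) : EReal) * (-(elog (μ (bowenBall T n ε x))))) atTop

/-- Measure-theoretic lower pressure `P̲_μ(T,f) = ∫ P̲_μ(T,f,x) dμ(x)`. -/
noncomputable def lowerPres [MeasurableSpace (X 0)] (μ : Measure (X 0))
    (T : ∀ k, X k → X (k + 1)) (f : ∀ k, X k → ℝ) : EReal :=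
  eInt μ (fun x => localLowerPres μ T f x)

/-- Measure-theoretic upper pressure `P̄_μ(T,f) = ∫ P̄_μ(T,f,x) dμ(x)`. -/
noncomputable def upperPres [MeasurableSpace (X 0)] (μ : Measure (X 0))
    (T : ∀ k, X k → X (k + 1)) (f : ∀ k, X k → ℝ) : EReal :=
  eInt μ (fun x => localUpperPres μ T f x)

/-- Measure-theoretic lower entropy `h̲_μ(T) = ∫ h̲_μ(T,x) dμ(x)`. -/
noncomputable def lowerEnt [MeasurableSpace (X 0)] (μ : Measure (X 0))
    (T : ∀ k, X k → X (k + 1)) : EReal :=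
  eInt μ (fun x => localLowerEnt μ T x)

/-- Measure-theoretic upper entropy `h̄_μ(T) = ∫ h̄_μ(T,x) dμ(x)`. -/
noncomputable def upperEnt [MeasurableSpace (X 0)] (μ : Measure (X 0))
    (T : ∀ k, X k → X (k + 1)) : EReal :=
  eInt μ (fun x => localUpperEnt μ T x)

/-- The Bowen premeasure `M^s_{N,ε}(T,f,Z)`: the infimum of
`∑ exp(-n_i s + S_{n_i}^T f(x_i))` over all countable `(N,ε)`-covers of `Z` by open
Bowen balls `B_{n_i}^T(x_i,ε)` with `n_i ≥ N`. -/
noncomputable def bowenPre (T : ∀ k, X k → X (k + 1)) (f : ∀ k, X k → ℝ)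
    (s : ℝ) (N : ℕ) (ε : ℝ) (Z : Set (X 0)) : ℝ≥0∞ :=
  ⨅ (D : Set (X 0 × ℕ)) (_ : D.Countable) (_ : ∀ p ∈ D, N ≤ p.2)
      (_ : Z ⊆ ⋃ p ∈ D, bowenBall T p.2 ε p.1),
    ∑' p : D, ENNReal.ofReal (Real.exp (-(p.1.2 : ℝ) * s + birk T f p.1.2 p.1.1))

/-- `M^s_ε(T,f,Z) = lim_{N→∞} M^s_{N,ε}(T,f,Z)` (an increasing limit). -/
noncomputable def bowenPreLim (T : ∀ k, X k → X (k + 1)) (f : ∀ k, X k → ℝ)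
    (s : ℝ) (ε : ℝ) (Z : Set (X 0)) : ℝ≥0∞ :=
  ⨆ N : ℕ, bowenPre T f s N ε Z

/-- The critical value `P^B(T,f,Z,ε) = inf {s : M^s_ε(T,f,Z) = 0}`. -/
noncomputable def bowenCrit (T : ∀ k, X k → X (k + 1)) (f : ∀ k, X k → ℝ)
    (ε : ℝ) (Z : Set (X 0)) : EReal :=
  ⨅ (s : ℝ) (_ : bowenPreLim T f s ε Z = 0), (s : EReal)

/-- The Bowen (Pesin–Pitskel') topological pressure
`P^B(T,f,Z) = lim_{ε→0} P^B(T,f,Z,ε)` (an increasing limit as `ε ↓ 0`). -/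
noncomputable def bowenP (T : ∀ k, X k → X (k + 1)) (f : ∀ k, X k → ℝ)
    (Z : Set (X 0)) : EReal :=
  ⨆ (ε : ℝ) (_ : 0 < ε), bowenCrit T f ε Z

/-- The Bowen topological entropy `h^B(T,Z) = P^B(T,0,Z)`. -/
noncomputable def bowenEnt (T : ∀ k, X k → X (k + 1)) (Z : Set (X 0)) : EReal :=
  bowenP T (fun k => fun _ : X k => (0 : ℝ)) Z

/-- The premeasure `N^s_{N,ε}(T,f,Z)` using suprema of Birkhoff sums over the balls. -/
noncomputable def nBowenPre (T : ∀ k, X k → X (k + 1)) (f : ∀ k, X k → ℝ)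
    (s : ℝ) (N : ℕ) (ε : ℝ) (Z : Set (X 0)) : ℝ≥0∞ :=
  ⨅ (D : Set (X 0 × ℕ)) (_ : D.Countable) (_ : ∀ p ∈ D, N ≤ p.2)
      (_ : Z ⊆ ⋃ p ∈ D, bowenBall T p.2 ε p.1),
    ∑' p : D, ENNReal.ofReal
      (Real.exp (-(p.1.2 : ℝ) * s + supBirk T f p.1.2 (bowenBall T p.1.2 ε p.1.1)))

/-- `N^s_ε(T,f,Z) = lim_{N→∞} N^s_{N,ε}(T,f,Z)`. -/
noncomputable def nBowenPreLim (T : ∀ k, X k → X (k + 1)) (f : ∀ k, X k → ℝ)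
    (s : ℝ) (ε : ℝ) (Z : Set (X 0)) : ℝ≥0∞ :=
  ⨆ N : ℕ, nBowenPre T f s N ε Z

/-- The critical value `Q^B(T,f,Z,ε) = inf {s : N^s_ε(T,f,Z) = 0}`. -/
noncomputable def nBowenCrit (T : ∀ k, X k → X (k + 1)) (f : ∀ k, X k → ℝ)
    (ε : ℝ) (Z : Set (X 0)) : EReal :=
  ⨅ (s : ℝ) (_ : nBowenPreLim T f s ε Z = 0), (s : EReal)

/-- The weighted Bowen premeasure `W^s_{N,ε}(T,f,g)`: the infimum of
`∑ c_i exp(-n_i s + sup_{B_{n_i}^T(x_i,ε)} S_{n_i}^T f)` over all countable families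
`{(B_{n_i}^T(x_i,ε), c_i)}` with `0 < c_i`, `n_i ≥ N` and `∑ c_i χ_{B_i} ≥ g`. -/
noncomputable def wBowenPre (T : ∀ k, X k → X (k + 1)) (f : ∀ k, X k → ℝ)
    (s : ℝ) (N : ℕ) (ε : ℝ) (g : X 0 → ℝ) : ℝ≥0∞ :=
  ⨅ (D : Set ((X 0 × ℕ) × ℝ)) (_ : D.Countable)
      (_ : ∀ p ∈ D, N ≤ p.1.2 ∧ 0 < p.2)
      (_ : ∀ x : X 0, ENNReal.ofReal (g x) ≤
        ∑' p : D, (bowenBall T p.1.1.2 ε p.1.1.1).indicator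
          (fun _ => ENNReal.ofReal p.1.2) x),
    ∑' p : D, ENNReal.ofReal p.1.2 *
      ENNReal.ofReal
        (Real.exp (-(p.1.1.2 : ℝ) * s + supBirk T f p.1.1.2 (bowenBall T p.1.1.2 ε p.1.1.1)))

/-- `D` is a countable `(N,ε)`-packing of `Z`: the closed Bowen balls
`B̄_{n}^T(x,ε)`, `(x,n) ∈ D`, are pairwise disjoint with centers in `Z` and orders `≥ N`. -/
def IsPacking (T : ∀ k, X k → X (k + 1)) (N : ℕ) (ε : ℝ) (Z : Set (X 0))
    (D : Set (X 0 × ℕ)) : Prop :=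
  D.Countable ∧ (∀ p ∈ D, p.1 ∈ Z ∧ N ≤ p.2) ∧
    ∀ p ∈ D, ∀ q ∈ D, p ≠ q →
      Disjoint (bowenClosedBall T p.2 ε p.1) (bowenClosedBall T q.2 ε q.1)

/-- The packing premeasure `P^s_{N,ε}(T,f,Z)`: the supremum of
`∑ exp(-n_i s + S_{n_i}^T f(x_i))` over all countable `(N,ε)`-packings of `Z`. -/
noncomputable def packPre (T : ∀ k, X k → X (k + 1)) (f : ∀ k, X k → ℝ)
    (s : ℝ) (N : ℕ) (ε : ℝ) (Z : Set (X 0)) : ℝ≥0∞ :=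
  ⨆ (D : Set (X 0 × ℕ)) (_ : IsPacking T N ε Z D),
    ∑' p : D, ENNReal.ofReal (Real.exp (-(p.1.2 : ℝ) * s + birk T f p.1.2 p.1.1))

/-- `P^s_{∞,ε}(T,f,Z) = lim_{N→∞} P^s_{N,ε}(T,f,Z)` (a decreasing limit). -/
noncomputable def packPreInf (T : ∀ k, X k → X (k + 1)) (f : ∀ k, X k → ℝ)
    (s : ℝ) (ε : ℝ) (Z : Set (X 0)) : ℝ≥0∞ :=
  ⨅ N : ℕ, packPre T f s N ε Z

/-- The packing measure-like quantity
`P^s_ε(T,f,Z) = inf { ∑_i P^s_{∞,ε}(T,f,Z_i) : Z ⊆ ⋃_i Z_i }`. -/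
noncomputable def packMeasure (T : ∀ k, X k → X (k + 1)) (f : ∀ k, X k → ℝ)
    (s : ℝ) (ε : ℝ) (Z : Set (X 0)) : ℝ≥0∞ :=
  ⨅ (Zs : ℕ → Set (X 0)) (_ : Z ⊆ ⋃ i, Zs i), ∑' i, packPreInf T f s ε (Zs i)

/-- The critical value `P^P(T,f,Z,ε) = inf {s : P^s_ε(T,f,Z) = 0}`. -/
noncomputable def packCrit (T : ∀ k, X k → X (k + 1)) (f : ∀ k, X k → ℝ)
    (ε : ℝ) (Z : Set (X 0)) : EReal :=
  ⨅ (s : ℝ) (_ : packMeasure T f s ε Z = 0), (s : EReal)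

/-- The packing topological pressure `P^P(T,f,Z) = lim_{ε→0} P^P(T,f,Z,ε)`. -/
noncomputable def packP (T : ∀ k, X k → X (k + 1)) (f : ∀ k, X k → ℝ)
    (Z : Set (X 0)) : EReal :=
  ⨆ (ε : ℝ) (_ : 0 < ε), packCrit T f ε Z

/-- The packing topological entropy `h^P(T,Z) = P^P(T,0,Z)`. -/
noncomputable def packEnt (T : ∀ k, X k → X (k + 1)) (Z : Set (X 0)) : EReal :=
  packP T (fun k => fun _ : X k => (0 : ℝ)) Z

/-- The packing premeasure `Q^s_{N,ε}(T,f,Z)` using suprema of Birkhoff sums over the balls. -/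
noncomputable def qPackPre (T : ∀ k, X k → X (k + 1)) (f : ∀ k, X k → ℝ)
    (s : ℝ) (N : ℕ) (ε : ℝ) (Z : Set (X 0)) : ℝ≥0∞ :=
  ⨆ (D : Set (X 0 × ℕ)) (_ : IsPacking T N ε Z D),
    ∑' p : D, ENNReal.ofReal
      (Real.exp (-(p.1.2 : ℝ) * s + supBirk T f p.1.2 (bowenClosedBall T p.1.2 ε p.1.1)))

/-- `Q^s_{∞,ε}(T,f,Z) = lim_{N→∞} Q^s_{N,ε}(T,f,Z)`. -/
noncomputable def qPackPreInf (T : ∀ k, X k → X (k + 1)) (f : ∀ k, X k → ℝ)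
    (s : ℝ) (ε : ℝ) (Z : Set (X 0)) : ℝ≥0∞ :=
  ⨅ N : ℕ, qPackPre T f s N ε Z

/-- `Q^s_ε(T,f,Z) = inf { ∑_i Q^s_{∞,ε}(T,f,Z_i) : Z ⊆ ⋃_i Z_i }`. -/
noncomputable def qPackMeasure (T : ∀ k, X k → X (k + 1)) (f : ∀ k, X k → ℝ)
    (s : ℝ) (ε : ℝ) (Z : Set (X 0)) : ℝ≥0∞ :=
  ⨅ (Zs : ℕ → Set (X 0)) (_ : Z ⊆ ⋃ i, Zs i), ∑' i, qPackPreInf T f s ε (Zs i)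

/-- The critical value `Q^P(T,f,Z,ε) = inf {s : Q^s_ε(T,f,Z) = 0}`. -/
noncomputable def qPackCrit (T : ∀ k, X k → X (k + 1)) (f : ∀ k, X k → ℝ)
    (ε : ℝ) (Z : Set (X 0)) : EReal :=
  ⨅ (s : ℝ) (_ : qPackMeasure T f s ε Z = 0), (s : EReal)

end Metric

/-- The distance function of an explicitly given metric space structure. -/
def mdist {α : Type*} (m : MetricSpace α) (x y : α) : ℝ :=
  @dist α m.toPseudoMetricSpace.toDist x y

end NDS

namespace NDS

universe u

/-! ### Extended-real bookkeeping -/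

lemma ofENN_mono {a b : ℝ≥0∞} (h : a ≤ b) : ofENN a ≤ ofENN b := by
  unfold ofENN
  split_ifs with ha hb hb
  · exact le_rfl
  · exact absurd (top_le_iff.1 (ha ▸ h)) hb
  · exact le_top
  · exact EReal.coe_le_coe_iff.2 (ENNReal.toReal_mono hb h)

lemma ofENN_ofReal {s : ℝ} (hs : 0 ≤ s) : ofENN (ENNReal.ofReal s) = (s : EReal) := by
  simp [ofENN, ENNReal.toReal_ofReal hs]

lemma toENN_coe (s : ℝ) : toENN (s : EReal) = ENNReal.ofReal s := by
  simp [toENN]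

lemma toENN_mono {a b : EReal} (h : a ≤ b) : toENN a ≤ toENN b := by
  unfold toENN
  split_ifs with ha hb hb
  · exact le_rfl
  · exact absurd (top_le_iff.1 (ha ▸ h)) hb
  · exact le_top
  · rcases eq_or_ne a ⊥ with rfl | ha'
    · simp
    · exact ENNReal.ofReal_le_ofReal (EReal.toReal_le_toReal h ha' hb)

lemma toENN_neg_of_nonneg {a : EReal} (h : 0 ≤ a) : toENN (-a) = 0 := by
  have h1 : -a ≤ ((0 : ℝ) : EReal) := by simpa using EReal.neg_le_neg_iff.2 h
  have h2 := toENN_mono h1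
  rw [toENN_coe, ENNReal.ofReal_zero] at h2
  exact le_antisymm h2 bot_le

/-- Exponential decay of `a` at rate `s` in terms of the extended logarithm. -/
lemma le_inv_mul_neg_elog_iff {n : ℕ} (hn : 1 ≤ n) (s : ℝ) (a : ℝ≥0∞) :
    (s : EReal) ≤ (((n : ℝ)⁻¹ : ℝ) : EReal) * (-(elog a)) ↔
      a ≤ ENNReal.ofReal (Real.exp (-(n : ℝ) * s)) := by
  have hn' : (0 : ℝ) < n := by exact_mod_cast hn
  have hinv : (0 : ℝ) < (n : ℝ)⁻¹ := inv_pos.2 hn'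
  unfold elog
  split_ifs with h0 ht
  · subst h0
    simp [EReal.coe_mul_top_of_pos hinv]
  · subst ht
    simp [EReal.coe_mul_bot_of_pos hinv]
  · have hpos : 0 < a.toReal := ENNReal.toReal_pos h0 ht
    rw [← EReal.coe_neg, ← EReal.coe_mul, EReal.coe_le_coe_iff, ENNReal.le_ofReal_iff_toReal_le ht
      (Real.exp_pos _).le, ← Real.log_le_iff_le_exp hpos, inv_mul_eq_div, le_div_iff₀ hn']
    constructor <;> intro h <;> linarith

section Metric

variable {X : ℕ → Type u} [∀ k, MetricSpace (X k)] {T : ∀ k, X k → X (k + 1)}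

lemma continuous_iter (hT : ∀ k, Continuous (T k)) : ∀ j, Continuous (iter T j)
  | 0 => continuous_id
  | j + 1 => (hT j).comp (continuous_iter hT j)

lemma isOpen_bowenBall (hT : ∀ k, Continuous (T k)) (n : ℕ) (ε : ℝ) (x : X 0) :
    IsOpen (bowenBall T n ε x) := by
  have : bowenBall T n ε x = ⋂ j ∈ Finset.range n, {y | dist (iter T j x) (iter T j y) < ε} := by
    ext y; simp [bowenBall]
  rw [this]
  exact isOpen_biInter_finset fun j _ =>
    isOpen_lt (continuous_const.dist (continuous_iter hT j)) continuous_const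

lemma mem_bowenBall_self {ε : ℝ} (hε : 0 < ε) (n : ℕ) (x : X 0) : x ∈ bowenBall T n ε x := by
  intro j _; simpa using hε

lemma mem_bowenClosedBall_self {ε : ℝ} (hε : 0 ≤ ε) (n : ℕ) (x : X 0) :
    x ∈ bowenClosedBall T n ε x := by
  intro j _; simpa using hε

lemma bowenBall_subset_closedBall (n : ℕ) (ε : ℝ) (x : X 0) :
    bowenBall T n ε x ⊆ bowenClosedBall T n ε x := fun _ hy j hj => (hy j hj).le

lemma bowenBall_mono {ε δ : ℝ} (h : ε ≤ δ) (n : ℕ) (x : X 0) :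
    bowenBall T n ε x ⊆ bowenBall T n δ x := fun _ hy j hj => (hy j hj).trans_le h

/-! ### Local entropy -/

section Entropy

variable [MeasurableSpace (X 0)] {μ : Measure (X 0)}

lemma le_localUpperEnt_of_frequently {x : X 0} {s ε : ℝ} (hε : 0 < ε)
    (h : ∃ᶠ n : ℕ in atTop, μ (bowenBall T n ε x) ≤ ENNReal.ofReal (Real.exp (-(n : ℝ) * s))) :
    (s : EReal) ≤ localUpperEnt μ T x := by
  refine le_iSup₂_of_le ε hε (le_limsup_of_frequently_le ?_)
  exact (h.and_eventually (eventually_ge_atTop 1)).mono fun n hn =>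
    (le_inv_mul_neg_elog_iff hn.2 s _).2 hn.1

lemma frequently_measure_bowenBall_le {x : X 0} {s : ℝ} (h : (s : EReal) < localUpperEnt μ T x) :
    ∃ ε > 0, ∃ᶠ n : ℕ in atTop,
      μ (bowenBall T n ε x) ≤ ENNReal.ofReal (Real.exp (-(n : ℝ) * s)) := by
  simp only [localUpperEnt, lt_iSup_iff] at h
  obtain ⟨ε, hε, h⟩ := h
  refine ⟨ε, hε, ?_⟩
  exact ((frequently_lt_of_lt_limsup (by isBoundedDefault) h).and_eventually
    (eventually_ge_atTop 1)).mono fun n hn => (le_inv_mul_neg_elog_iff hn.2 s _).1 hn.1.le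

lemma localUpperEnt_nonneg [IsProbabilityMeasure μ] (x : X 0) : 0 ≤ localUpperEnt μ T x := by
  have : ((0 : ℝ) : EReal) ≤ localUpperEnt μ T x :=
    le_localUpperEnt_of_frequently one_pos (Frequently.of_forall fun n => by simpa using prob_le_one)
  simpa using this

lemma upperEnt_eq_ofENN [IsProbabilityMeasure μ] :
    upperEnt μ T = ofENN (∫⁻ x, toENN (localUpperEnt μ T x) ∂μ) := by
  simp [upperEnt, eInt, toENN_neg_of_nonneg (localUpperEnt_nonneg _), ofENN]

lemma le_upperEnt [IsProbabilityMeasure μ] {s : ℝ} (hs : 0 ≤ s)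
    (h : ∀ᵐ x ∂μ, (s : EReal) ≤ localUpperEnt μ T x) : (s : EReal) ≤ upperEnt μ T := by
  rw [upperEnt_eq_ofENN, ← ofENN_ofReal hs]
  refine ofENN_mono ?_
  calc ENNReal.ofReal s = ∫⁻ _, ENNReal.ofReal s ∂μ := by simp
    _ ≤ _ := lintegral_mono_ae (h.mono fun x hx => by simpa [toENN_coe] using toENN_mono hx)

lemma upperEnt_le [IsProbabilityMeasure μ] {s : ℝ}
    (h : ∀ᵐ x ∂μ, localUpperEnt μ T x ≤ (s : EReal)) : upperEnt μ T ≤ (s : EReal) := by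
  have hs : 0 ≤ s := by
    obtain ⟨x, hx⟩ := h.exists
    exact_mod_cast (localUpperEnt_nonneg x).trans hx
  rw [upperEnt_eq_ofENN, ← ofENN_ofReal hs]
  refine ofENN_mono ?_
  calc _ ≤ ∫⁻ _, ENNReal.ofReal s ∂μ :=
        lintegral_mono_ae (h.mono fun x hx => by simpa [toENN_coe] using toENN_mono hx)
    _ = ENNReal.ofReal s := by simp

end Entropy

/-! ### Packing premeasures for the zero potential -/

/-- The zero potential. -/
abbrev zeroPotential (X : ℕ → Type u) : ∀ k, X k → ℝ := fun _ _ => 0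

lemma packPre_zero_eq (T : ∀ k, X k → X (k + 1)) (s : ℝ) (N : ℕ) (ε : ℝ) (Z : Set (X 0)) :
    packPre T (zeroPotential X) s N ε Z = ⨆ (D : Set (X 0 × ℕ)) (_ : IsPacking T N ε Z D),
      ∑' p : D, ENNReal.ofReal (Real.exp (-(p.1.2 : ℝ) * s)) := by
  simp [packPre, birk]

lemma IsPacking.mono {N : ℕ} {ε : ℝ} {Z W : Set (X 0)} {D : Set (X 0 × ℕ)}
    (h : IsPacking T N ε Z D) (hZW : Z ⊆ W) : IsPacking T N ε W D :=
  ⟨h.1, fun p hp => ⟨hZW (h.2.1 p hp).1, (h.2.1 p hp).2⟩, h.2.2⟩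

lemma IsPacking.subset {N : ℕ} {ε : ℝ} {Z : Set (X 0)} {D E : Set (X 0 × ℕ)}
    (h : IsPacking T N ε Z D) (hE : E ⊆ D) : IsPacking T N ε Z E :=
  ⟨h.1.mono hE, fun p hp => h.2.1 p (hE hp), fun p hp q hq => h.2.2 p (hE hp) q (hE hq)⟩

lemma packPre_mono {s ε : ℝ} {N : ℕ} {f : ∀ k, X k → ℝ} {Z W : Set (X 0)} (h : Z ⊆ W) :
    packPre T f s N ε Z ≤ packPre T f s N ε W :=
  iSup_mono fun _ => iSup_mono' fun hD => ⟨hD.mono h, le_rfl⟩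

lemma packPreInf_mono {s ε : ℝ} {f : ∀ k, X k → ℝ} {Z W : Set (X 0)} (h : Z ⊆ W) :
    packPreInf T f s ε Z ≤ packPreInf T f s ε W :=
  iInf_mono fun _ => packPre_mono h

lemma packPreInf_empty (T : ∀ k, X k → X (k + 1)) (f : ∀ k, X k → ℝ) (s ε : ℝ) :
    packPreInf T f s ε ∅ = 0 := by
  refine le_antisymm (iInf_le_of_le 0 (iSup₂_le fun D hD => ?_)) bot_le
  have : D = ∅ := eq_empty_of_forall_notMem fun p hp => (hD.2.1 p hp).1
  subst this
  simp

/-- `packMeasure` as an outer measure. -/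
noncomputable def packOuter (T : ∀ k, X k → X (k + 1)) (f : ∀ k, X k → ℝ) (s ε : ℝ) :
    OuterMeasure (X 0) :=
  OuterMeasure.ofFunction (packPreInf T f s ε) (packPreInf_empty T f s ε)

lemma packOuter_apply (f : ∀ k, X k → ℝ) (s ε : ℝ) (Z : Set (X 0)) :
    packOuter T f s ε Z = packMeasure T f s ε Z := rfl

/-! ### The upper bound -/

section UpperBound

variable [∀ k, CompactSpace (X k)] [MeasurableSpace (X 0)] {μ : Measure (X 0)}

/-- A set whose points have small Bowen balls of a fixed order is controlled by its packing
premeasure. -/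
lemma measure_le_mul_packPre (hT : ∀ k, Continuous (T k)) {s t ε : ℝ} (hε : 0 < ε) {N n : ℕ}
    (hN : N ≤ n) {Z : Set (X 0)}
    (hZ : ∀ x ∈ Z, μ (bowenBall T n (3 * ε) x) ≤ ENNReal.ofReal (Real.exp (-(n : ℝ) * s))) :
    μ Z ≤ ENNReal.ofReal (Real.exp (n * (t - s))) * packPre T (zeroPotential X) t N ε Z := by
  obtain ⟨u, huZ, hud, hcov⟩ := Vitali.exists_disjoint_subfamily_covering_enlargement
    (fun x => bowenClosedBall T n ε x) Z (fun _ => (1 : ℝ)) 2 one_lt_two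
    (fun _ _ => zero_le_one) 1 (fun _ _ => le_rfl)
    (fun x _ => ⟨x, mem_bowenClosedBall_self hε.le n x⟩)
  have hcount : u.Countable := hud.countable_of_nonempty_interior fun x _ =>
    ⟨x, interior_maximal (bowenBall_subset_closedBall n ε x) (isOpen_bowenBall hT n ε x)
      (mem_bowenBall_self hε n x)⟩
  have hsub : Z ⊆ ⋃ x ∈ u, bowenBall T n (3 * ε) x := by
    intro x hx
    obtain ⟨y, hyu, ⟨z, hzx, hzy⟩, -⟩ := hcov x hx
    refine mem_iUnion₂.2 ⟨y, hyu, fun j hj => ?_⟩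
    have h1 := hzx j hj
    have h2 := hzy j hj
    have h3 := dist_triangle_right (iter T j y) (iter T j x) (iter T j z)
    linarith
  have hpack : IsPacking T N ε Z ((fun x => (x, n)) '' u) := by
    refine ⟨hcount.image _, ?_, ?_⟩
    · rintro _ ⟨x, hx, rfl⟩
      exact ⟨huZ hx, hN⟩
    · rintro _ ⟨x, hx, rfl⟩ _ ⟨y, hy, rfl⟩ hne
      exact hud hx hy fun h => hne (by rw [h])
  have hinj : InjOn (fun x : X 0 => (x, n)) u := fun x _ y _ h => congrArg Prod.fst h
  calc μ Z ≤ ∑' x : u, μ (bowenBall T n (3 * ε) x) :=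
        (measure_mono hsub).trans (measure_biUnion_le μ hcount _)
    _ ≤ ∑' _ : u, ENNReal.ofReal (Real.exp (-(n : ℝ) * s)) :=
        ENNReal.tsum_le_tsum fun x => hZ x (huZ x.2)
    _ = ENNReal.ofReal (Real.exp (n * (t - s))) *
          ∑' _ : u, ENNReal.ofReal (Real.exp (-(n : ℝ) * t)) := by
        rw [← ENNReal.tsum_mul_left]
        congr 1; ext
        rw [← ENNReal.ofReal_mul (Real.exp_pos _).le, ← Real.exp_add]
        congr 2; ring
    _ ≤ _ := by
        gcongr
        rw [packPre_zero_eq]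
        refine le_iSup₂_of_le _ hpack (le_of_eq ?_)
        exact (tsum_image
          (fun p : X 0 × ℕ => ENNReal.ofReal (Real.exp (-(p.2 : ℝ) * t))) hinj).symm

lemma tsum_exp_ne_top {r : ℝ} (hr : r < 0) :
    ∑' n : ℕ, ENNReal.ofReal (Real.exp (n * r)) ≠ ⊤ := by
  have h1 : ENNReal.ofReal (Real.exp r) < 1 := by
    simpa [ENNReal.ofReal_lt_one] using hr
  have h2 : ∀ n : ℕ, ENNReal.ofReal (Real.exp (n * r)) = ENNReal.ofReal (Real.exp r) ^ n :=
    fun n => by rw [Real.exp_nat_mul, ENNReal.ofReal_pow (Real.exp_pos _).le]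
  simp only [h2, ENNReal.tsum_geometric]
  exact ENNReal.inv_ne_top.2 (tsub_pos_of_lt h1).ne'

lemma measure_le_mul_packPreInf (hT : ∀ k, Continuous (T k)) {s t ε : ℝ} (hε : 0 < ε) (hts : t < s)
    {E : Set (X 0)}
    (hE : ∀ x ∈ E, ∃ᶠ n : ℕ in atTop,
      μ (bowenBall T n (3 * ε) x) ≤ ENNReal.ofReal (Real.exp (-(n : ℝ) * s))) :
    μ E ≤ (∑' n : ℕ, ENNReal.ofReal (Real.exp (n * (t - s)))) *
      packPreInf T (zeroPotential X) t ε E := by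
  have hC := tsum_exp_ne_top (sub_neg.2 hts)
  rw [packPreInf, ENNReal.mul_iInf_of_ne (fun h => ?_) hC]
  swap
  · have := ENNReal.tsum_eq_zero.1 h 0
    simp at this
  refine le_iInf fun N => ?_
  let F : ℕ → Set (X 0) := fun n => {x ∈ E | N ≤ n ∧
    μ (bowenBall T n (3 * ε) x) ≤ ENNReal.ofReal (Real.exp (-(n : ℝ) * s))}
  have hF : E ⊆ ⋃ n, F n := fun x hx => by
    obtain ⟨n, hn, h⟩ := (frequently_atTop.1 (hE x hx)) N
    exact mem_iUnion.2 ⟨n, hx, hn, h⟩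
  calc μ E ≤ ∑' n, μ (F n) := (measure_mono hF).trans (measure_iUnion_le _)
    _ ≤ ∑' n : ℕ, ENNReal.ofReal (Real.exp (n * (t - s))) *
          packPre T (zeroPotential X) t N ε E := by
        refine ENNReal.tsum_le_tsum fun n => ?_
        by_cases hn : N ≤ n
        · refine (measure_le_mul_packPre hT (t := t) hε hn fun x hx => hx.2.2).trans ?_
          gcongr
          exact packPre_mono fun x hx => hx.1
        · have : F n = ∅ := eq_empty_of_forall_notMem fun x hx => hn hx.2.1
          simp [this]
    _ = _ := ENNReal.tsum_mul_right

lemma packMeasure_ne_zero (hT : ∀ k, Continuous (T k)) {s t ε : ℝ} (hε : 0 < ε) (hts : t < s)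
    {K E : Set (X 0)} (hEK : E ⊆ K) (hμE : μ E ≠ 0)
    (hE : ∀ x ∈ E, ∃ᶠ n : ℕ in atTop,
      μ (bowenBall T n (3 * ε) x) ≤ ENNReal.ofReal (Real.exp (-(n : ℝ) * s))) :
    packMeasure T (zeroPotential X) t ε K ≠ 0 := by
  have hC := tsum_exp_ne_top (sub_neg.2 hts)
  set C := ∑' n : ℕ, ENNReal.ofReal (Real.exp (n * (t - s)))
  have hle : μ E / C ≤ packMeasure T (zeroPotential X) t ε K := by
    refine le_iInf₂ fun Zs hZs => ENNReal.div_le_of_le_mul' ?_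
    calc μ E ≤ ∑' i, μ (E ∩ Zs i) := by
          refine (measure_mono ?_).trans (measure_iUnion_le _)
          rw [← inter_iUnion]
          exact subset_inter Subset.rfl (hEK.trans hZs)
      _ ≤ ∑' i, C * packPreInf T (zeroPotential X) t ε (Zs i) := by
          refine ENNReal.tsum_le_tsum fun i => ?_
          refine (measure_le_mul_packPreInf hT hε hts fun x hx => hE x hx.1).trans ?_
          gcongr
          exact packPreInf_mono inter_subset_right
      _ = _ := ENNReal.tsum_mul_left
  exact ((ENNReal.div_pos hμE hC).trans_le hle).ne'

lemma upperEnt_le_packEnt (hT : ∀ k, Continuous (T k)) {K : Set (X 0)} [IsProbabilityMeasure μ]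
    (hK : ∀ᵐ x ∂μ, x ∈ K) : upperEnt μ T ≤ packEnt T K := by
  by_contra! hlt
  obtain ⟨s, hs1, hs2⟩ := EReal.lt_iff_exists_real_btwn.1 hlt
  let E : ℕ → Set (X 0) := fun k => {x ∈ K | ∃ᶠ n : ℕ in atTop,
    μ (bowenBall T n (3 * (1 / ((k : ℝ) + 1))) x) ≤ ENNReal.ofReal (Real.exp (-(n : ℝ) * s))}
  obtain ⟨k, hk⟩ : ∃ k, μ (E k) ≠ 0 := by
    by_contra! h0
    refine hs2.not_ge (upperEnt_le ?_)
    have hnull : ∀ᵐ x ∂μ, x ∉ ⋃ k, E k := measure_eq_zero_iff_ae_notMem.1 (measure_iUnion_null h0)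
    filter_upwards [hK, hnull] with x hxK hx
    by_contra! hgt
    obtain ⟨ε, hε, hfreq⟩ := frequently_measure_bowenBall_le hgt
    obtain ⟨k, hk⟩ := exists_nat_one_div_lt (show 0 < ε / 3 by positivity)
    exact hx (mem_iUnion.2 ⟨k, hxK, hfreq.mono fun n hn =>
      (measure_mono (bowenBall_mono (by linarith) n x)).trans hn⟩)
  have hε : (0 : ℝ) < 1 / ((k : ℝ) + 1) := by positivity
  refine hs1.not_ge (le_iSup₂_of_le _ hε (le_iInf₂ fun t ht => ?_))
  by_contra! hts
  exact packMeasure_ne_zero hT hε (by exact_mod_cast hts) (fun x hx => hx.1) hk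
    (fun x hx => hx.2) ht

end UpperBound

/-! ### The lower bound -/

section LowerBound

/-- Finitely many points of `C` carry a probability vector `mass` whose weights are at most
`exp (-ord i * s)`, and whose `rad`-neighbourhoods are separated beyond `ε` before time `ord i`. -/
structure PackingStage (T : ∀ k, X k → X (k + 1)) (C : Set (X 0)) (s ε : ℝ) where
  /-- The index type of the points. -/
  ι : Type u
  /-- There are finitely many points. -/
  fin : Fintype ι
  /-- The points. -/
  pt : ι → X 0
  /-- The orders of the Bowen balls around the points. -/
  ord : ι → ℕ
  /-- The weights. -/
  mass : ι → ℝ≥0∞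
  /-- The common radius of the neighbourhoods. -/
  rad : ℝ
  rad_pos : 0 < rad
  pt_mem : ∀ i, pt i ∈ C
  sum_mass : ∑ i, mass i = 1
  mass_le : ∀ i, mass i ≤ ENNReal.ofReal (Real.exp (-(ord i : ℝ) * s))
  sep : ∀ i j, i ≠ j → ∀ z ∈ Metric.closedBall (pt i) rad, ∀ w ∈ Metric.closedBall (pt j) rad,
    ∃ k < ord i, ε < dist (iter T k z) (iter T k w)

attribute [instance] PackingStage.fin

/-- Separation of points of a finite family persists on small closed balls. -/
lemma eventually_closedBall_separated (hT : ∀ k, Continuous (T k)) {ε : ℝ} {ι : Type*} [Finite ι]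
    {pt : ι → X 0} {ord : ι → ℕ}
    (h : ∀ i j, i ≠ j → ∃ k < ord i, ε < dist (iter T k (pt i)) (iter T k (pt j))) :
    ∀ᶠ r in 𝓝[>] (0 : ℝ), ∀ i j, i ≠ j → ∀ z ∈ Metric.closedBall (pt i) r,
      ∀ w ∈ Metric.closedBall (pt j) r, ∃ k < ord i, ε < dist (iter T k z) (iter T k w) := by
  simp only [eventually_all]
  intro i j hij
  obtain ⟨k, hk, hd⟩ := h i j hij
  have hopen : IsOpen {p : X 0 × X 0 | ε < dist (iter T k p.1) (iter T k p.2)} :=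
    isOpen_lt continuous_const (((continuous_iter hT k).comp continuous_fst).dist
      ((continuous_iter hT k).comp continuous_snd))
  obtain ⟨δ, hδ, hsub⟩ := Metric.isOpen_iff.1 hopen (pt i, pt j) hd
  filter_upwards [Ioo_mem_nhdsGT hδ] with r hr z hz w hw
  refine ⟨k, hk, hsub (a := (z, w)) ?_⟩
  rw [Metric.mem_ball, Prod.dist_eq]
  exact max_lt (lt_of_le_of_lt hz hr.2) (lt_of_le_of_lt hw hr.2)

/-- If `packMeasure` at the exponent `t` does not vanish, then at any smaller exponent there are
finite packings of arbitrarily high order and of total weight at least `1`. -/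
lemma exists_finset_packing {s t ε : ℝ} (hst : s < t) {Z : Set (X 0)}
    (hZ : packMeasure T (zeroPotential X) t ε Z ≠ 0) (N : ℕ) :
    ∃ D : Finset (X 0 × ℕ), IsPacking T N ε Z (D : Set (X 0 × ℕ)) ∧
      1 ≤ ∑ p ∈ D, ENNReal.ofReal (Real.exp (-(p.2 : ℝ) * s)) := by
  have hpos : 0 < packPreInf T (zeroPotential X) t ε Z := by
    rw [← packOuter_apply] at hZ
    exact (pos_iff_ne_zero.2 hZ).trans_le (OuterMeasure.ofFunction_le Z)
  obtain ⟨c, hc0, hc⟩ := ENNReal.lt_iff_exists_nnreal_btwn.1 hpos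
  have hc0 : 0 < (c : ℝ) := by exact_mod_cast hc0
  obtain ⟨M, hM⟩ : ∃ M : ℕ, 1 ≤ Real.exp (M * (t - s)) * c := by
    have h1 : Tendsto (fun M : ℕ => Real.exp (M * (t - s))) atTop atTop :=
      Real.tendsto_exp_atTop.comp
        (tendsto_natCast_atTop_atTop.atTop_mul_const (sub_pos.2 hst))
    obtain ⟨M, hM⟩ := (h1.eventually_ge_atTop ((c : ℝ)⁻¹)).exists
    exact ⟨M, (inv_le_iff_one_le_mul₀ hc0).1 hM⟩
  have hc' := hc.trans_le (iInf_le _ (max N M))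
  rw [packPre_zero_eq] at hc'
  simp only [lt_iSup_iff] at hc'
  obtain ⟨D, hD, hlt⟩ := hc'
  rw [ENNReal.tsum_eq_iSup_sum, lt_iSup_iff] at hlt
  obtain ⟨F, hF⟩ := hlt
  refine ⟨F.map (Function.Embedding.subtype _), ?_, ?_⟩
  · have h := hD.subset (E := (F.map (Function.Embedding.subtype _) : Finset (X 0 × ℕ))) (by simp)
    exact ⟨h.1, fun p hp => ⟨(h.2.1 p hp).1, (le_max_left _ _).trans (h.2.1 p hp).2⟩, h.2.2⟩
  · rw [Finset.sum_map]
    calc (1 : ℝ≥0∞) ≤ ENNReal.ofReal (Real.exp (M * (t - s)) * c) := by simpa using hM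
      _ = ENNReal.ofReal (Real.exp (M * (t - s))) * c := by
          rw [ENNReal.ofReal_mul (Real.exp_pos _).le]; simp
      _ ≤ ENNReal.ofReal (Real.exp (M * (t - s))) *
            ∑ p ∈ F, ENNReal.ofReal (Real.exp (-(p.1.2 : ℝ) * t)) := by gcongr
      _ ≤ _ := by
          rw [Finset.mul_sum]
          refine Finset.sum_le_sum fun p _ => ?_
          rw [← ENNReal.ofReal_mul (Real.exp_pos _).le, ← Real.exp_add]
          refine ENNReal.ofReal_le_ofReal (Real.exp_le_exp.2 ?_)
          have hp : (M : ℝ) ≤ (p.1.2 : ℝ) := by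
            exact_mod_cast (le_max_right _ _).trans (hD.2.1 p.1 p.2).2
          have := mul_le_mul_of_nonneg_right hp (sub_pos.2 hst).le
          simp only [Function.Embedding.subtype_apply]
          linarith

namespace PackingStage

variable {C K : Set (X 0)} {s ε : ℝ}

lemma mass_le_one (S : PackingStage T C s ε) (i : S.ι) : S.mass i ≤ 1 :=
  S.sum_mass ▸ Finset.single_le_sum (fun _ _ => zero_le) (Finset.mem_univ i)

/-- The part in `K` of the neighbourhood of the `i`-th point. -/
def cell (S : PackingStage T C s ε) (K : Set (X 0)) (i : S.ι) : Set (X 0) :=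
  Metric.closedBall (S.pt i) S.rad ∩ K

lemma disjoint_cell (hε : 0 ≤ ε) (S : PackingStage T C s ε) :
    Pairwise (Function.onFun Disjoint (S.cell K)) := by
  intro i j hij
  refine Set.disjoint_left.2 fun z hi hj => ?_
  obtain ⟨k, -, hk⟩ := S.sep i j hij z hi.1 z hj.1
  rw [dist_self] at hk
  exact hk.not_ge hε

/-- The stage with a single point. -/
def single (x : X 0) (hx : x ∈ C) (s ε : ℝ) : PackingStage T C s ε where
  ι := PUnit
  fin := inferInstance
  pt _ := x
  ord _ := 0
  mass _ := 1
  rad := 1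
  rad_pos := one_pos
  pt_mem _ := hx
  sum_mass := by simp
  mass_le _ := by simp
  sep i j h := absurd (Subsingleton.elim i j) h

open Classical in
/-- The stage `R` refines `S`: every cell of `S` contains cells of `R` of the same total mass. -/
def Refines (R S : PackingStage T C s ε) : Prop :=
  ∃ π : R.ι → S.ι,
    (∀ j, Metric.closedBall (R.pt j) R.rad ⊆ Metric.closedBall (S.pt (π j)) S.rad) ∧
      ∀ i, S.mass i = ∑ j with π j = i, R.mass j

lemma exists_refines (hT : ∀ k, Continuous (T k)) (S : PackingStage T C s ε)
    (hC : ∀ x ∈ C, ∀ r > 0, ∀ N, ∃ D : Finset (X 0 × ℕ),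
      IsPacking T N ε (C ∩ Metric.ball x r) (D : Set (X 0 × ℕ)) ∧
        1 ≤ ∑ p ∈ D, ENNReal.ofReal (Real.exp (-(p.2 : ℝ) * s))) (hε : 0 ≤ ε) (N : ℕ) :
    ∃ R : PackingStage T C s ε, (∀ j, N ≤ R.ord j) ∧ R.Refines S := by
  have hrad : 0 < S.rad / 2 := half_pos S.rad_pos
  set M := max N (Finset.univ.sup S.ord)
  choose D hD hsum using fun i => hC (S.pt i) (S.pt_mem i) (S.rad / 2) hrad M
  have hordM : ∀ i, ∀ p ∈ D i, M ≤ p.2 := fun i p hp => ((hD i).2.1 p hp).2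
  have hmem : ∀ i, ∀ p ∈ D i, p.1 ∈ C := fun i p hp => ((hD i).2.1 p hp).1.1
  have hball : ∀ i, ∀ p ∈ D i, dist p.1 (S.pt i) < S.rad / 2 :=
    fun i p hp => ((hD i).2.1 p hp).1.2
  let e : X 0 × ℕ → ℝ≥0∞ := fun p => ENNReal.ofReal (Real.exp (-(p.2 : ℝ) * s))
  let W : S.ι → ℝ≥0∞ := fun i => ∑ p ∈ D i, e p
  have hW0 : ∀ i, W i ≠ 0 := fun i => (zero_lt_one.trans_le (hsum i)).ne'
  have hWtop : ∀ i, W i ≠ ⊤ := fun i => (ENNReal.sum_lt_top.2 fun p _ => ENNReal.ofReal_lt_top).ne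
  let J := Σ i : S.ι, {p // p ∈ D i}
  have hsep : ∀ a b : J, a ≠ b →
      ∃ k < a.2.1.2, ε < dist (iter T k a.2.1.1) (iter T k b.2.1.1) := by
    rintro ⟨i, p, hp⟩ ⟨j, q, hq⟩ hne
    by_cases hij : i = j
    · subst hij
      have hpq : p ≠ q := fun h => hne (by subst h; rfl)
      have hnot := Set.disjoint_right.1 ((hD i).2.2 p hp q hq hpq)
        (mem_bowenClosedBall_self hε q.2 q.1)
      simpa [bowenClosedBall] using hnot
    · obtain ⟨k, hk, hd⟩ := S.sep i j hij p.1
        (Metric.mem_closedBall.2 (by linarith [hball i p hp])) q.1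
        (Metric.mem_closedBall.2 (by linarith [hball j q hq]))
      refine ⟨k, hk.trans_le ?_, hd⟩
      exact (Finset.le_sup (f := S.ord) (Finset.mem_univ i)).trans
        ((le_max_right _ _).trans (hordM i p hp))
  obtain ⟨r, hr, hr0, hrS⟩ := ((eventually_closedBall_separated hT
    (pt := fun a : J => a.2.1.1) (ord := fun a : J => a.2.1.2) hsep).and
      (Ioo_mem_nhdsGT hrad)).exists
  let mass : J → ℝ≥0∞ := fun a => S.mass a.1 * (e a.2.1 / W a.1)
  have hfib : ∀ i, ∑ p : {p // p ∈ D i}, mass ⟨i, p⟩ = S.mass i := fun i => by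
    simp only [mass, ← Finset.mul_sum, div_eq_mul_inv, ← Finset.sum_mul]
    rw [Finset.sum_coe_sort (D i) e, ENNReal.mul_inv_cancel (hW0 i) (hWtop i), mul_one]
  refine ⟨⟨J, inferInstance, fun a => a.2.1.1, fun a => a.2.1.2, mass, r, hr0,
    fun a => hmem _ _ a.2.2, ?_, fun a => ?_, hr⟩, fun a => ?_, fun a => a.1, fun a => ?_,
    fun i => ?_⟩
  · rw [Fintype.sum_sigma]
    simp only [hfib, S.sum_mass]
  · calc S.mass a.1 * (e a.2.1 / W a.1) ≤ 1 * (e a.2.1 / 1) := by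
          gcongr
          · exact S.mass_le_one _
          · exact hsum _
      _ = _ := by simp [e]
  · exact (le_max_left _ _).trans (hordM _ _ a.2.2)
  · refine Metric.closedBall_subset_closedBall' ?_
    have := hball _ _ a.2.2
    linarith
  · classical
    rw [Finset.sum_filter, Fintype.sum_sigma, Finset.sum_eq_single i]
    · simp only [if_true, hfib]
    · intro j _ hj
      simp [hj]
    · simp

variable [MeasurableSpace (X 0)]

/-- The probability measures giving each cell at least its mass. -/
def measures (S : PackingStage T C s ε) (K : Set (X 0)) : Set (ProbabilityMeasure (X 0)) :=
  {μ | ∀ i, S.mass i ≤ (μ : Measure (X 0)) (S.cell K i)}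

section Borel

variable [BorelSpace (X 0)]

lemma measurableSet_cell (S : PackingStage T C s ε) (hK : IsClosed K) (i : S.ι) :
    MeasurableSet (S.cell K i) := (Metric.isClosed_closedBall.inter hK).measurableSet

lemma isClosed_measures (S : PackingStage T C s ε) (hK : IsClosed K) :
    IsClosed (S.measures K) := by
  rw [isClosed_iff_forall_filter]
  intro μ F _ hF hμ i
  have hlim := ProbabilityMeasure.limsup_measure_closed_le_of_tendsto (L := F) (μs := id)
    (μ := μ) hμ (Metric.isClosed_closedBall.inter hK : IsClosed (S.cell K i))
  refine le_trans ?_ hlim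
  refine le_limsup_of_frequently_le (Eventually.frequently ?_)
  filter_upwards [hF (mem_principal_self _)] with ν hν
  exact hν i

lemma nonempty_measures (S : PackingStage T C s ε) (hCK : C ⊆ K) :
    (S.measures K).Nonempty := by
  let ν : Measure (X 0) := ∑ i, S.mass i • Measure.dirac (S.pt i)
  have hν : IsProbabilityMeasure ν := ⟨by simp [ν, S.sum_mass]⟩
  refine ⟨⟨ν, hν⟩, fun i => ?_⟩
  have hi : S.pt i ∈ S.cell K i :=
    ⟨Metric.mem_closedBall_self S.rad_pos.le, hCK (S.pt_mem i)⟩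
  calc S.mass i = S.mass i * Measure.dirac (S.pt i) (S.cell K i) := by
        simp [Measure.dirac_apply_of_mem hi]
    _ ≤ ∑ j, S.mass j * Measure.dirac (S.pt j) (S.cell K i) :=
        Finset.single_le_sum (f := fun j => S.mass j * Measure.dirac (S.pt j) (S.cell K i))
          (fun _ _ => zero_le) (Finset.mem_univ i)
    _ = ν (S.cell K i) := by simp [ν]

open Classical in
lemma Refines.measures_subset {R S : PackingStage T C s ε} (h : R.Refines S) (hε : 0 ≤ ε)
    (hK : IsClosed K) : R.measures K ⊆ S.measures K := by
  obtain ⟨π, hπ, hmass⟩ := h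
  intro μ hμ i
  calc S.mass i = ∑ j with π j = i, R.mass j := hmass i
    _ ≤ ∑ j with π j = i, (μ : Measure (X 0)) (R.cell K j) := Finset.sum_le_sum fun j _ => hμ j
    _ = (μ : Measure (X 0)) (⋃ j ∈ Finset.univ.filter (fun j => π j = i), R.cell K j) :=
        (measure_biUnion_finset (fun a _ b _ hab => R.disjoint_cell hε hab)
          fun j _ => R.measurableSet_cell hK j).symm
    _ ≤ _ := measure_mono (iUnion₂_subset fun j hj => by
        obtain rfl := (Finset.mem_filter.1 hj).2
        exact inter_subset_inter_left _ (hπ j))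

lemma ae_mem_cell (S : PackingStage T C s ε) (hε : 0 ≤ ε) (hK : IsClosed K)
    {μ : ProbabilityMeasure (X 0)} (hμ : μ ∈ S.measures K) :
    ∀ᵐ x ∂(μ : Measure (X 0)), ∃ i, x ∈ S.cell K i := by
  have h : (μ : Measure (X 0)) (⋃ i, S.cell K i) = 1 := by
    refine le_antisymm prob_le_one ?_
    rw [measure_iUnion (S.disjoint_cell hε) (S.measurableSet_cell hK), tsum_fintype, ← S.sum_mass]
    exact Finset.sum_le_sum fun i _ => hμ i
  have := (prob_compl_eq_zero_iff (MeasurableSet.iUnion (S.measurableSet_cell hK))).2 h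
  filter_upwards [measure_eq_zero_iff_ae_notMem.1 this] with x hx
  simpa using hx

lemma measure_bowenBall_le (S : PackingStage T C s ε) (hε : 0 ≤ ε) (hK : IsClosed K)
    {μ : ProbabilityMeasure (X 0)} (hμ : μ ∈ S.measures K) {i : S.ι} {x : X 0}
    (hx : x ∈ S.cell K i) :
    (μ : Measure (X 0)) (bowenBall T (S.ord i) ε x) ≤
      ENNReal.ofReal (Real.exp (-(S.ord i : ℝ) * s)) := by
  classical
  refine le_trans ?_ (S.mass_le i)
  set U := ⋃ j ∈ Finset.univ.erase i, S.cell K j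
  have hU : MeasurableSet U :=
    Finset.measurableSet_biUnion _ fun j _ => S.measurableSet_cell hK j
  have hmU : ∑ j ∈ Finset.univ.erase i, S.mass j ≤ (μ : Measure (X 0)) U := by
    rw [measure_biUnion_finset (fun a _ b _ hab => S.disjoint_cell hε hab)
      fun j _ => S.measurableSet_cell hK j]
    exact Finset.sum_le_sum fun j _ => hμ j
  have hdisj : Disjoint (bowenBall T (S.ord i) ε x) U := by
    refine Set.disjoint_left.2 fun y hy hyU => ?_
    obtain ⟨j, hj, hyj⟩ := mem_iUnion₂.1 hyU
    obtain ⟨k, hk, hd⟩ := S.sep i j (Finset.ne_of_mem_erase hj).symm x hx.1 y hyj.1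
    exact lt_asymm hd (hy k hk)
  have hfin : ∑ j ∈ Finset.univ.erase i, S.mass j ≠ ⊤ :=
    (ENNReal.sum_lt_top.2 fun j _ => (S.mass_le_one j).trans_lt ENNReal.one_lt_top).ne
  refine (ENNReal.add_le_add_iff_right hfin).1 ?_
  rw [Finset.add_sum_erase _ _ (Finset.mem_univ i), S.sum_mass]
  calc _ ≤ (μ : Measure (X 0)) (bowenBall T (S.ord i) ε x) + (μ : Measure (X 0)) U := by gcongr
    _ = (μ : Measure (X 0)) (bowenBall T (S.ord i) ε x ∪ U) := (measure_union hdisj hU).symm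
    _ ≤ 1 := prob_le_one

end Borel

end PackingStage

variable [MeasurableSpace (X 0)] [BorelSpace (X 0)] [∀ k, CompactSpace (X k)]

lemma exists_measure_le_upperEnt (hT : ∀ k, Continuous (T k)) {K : Set (X 0)} (hK : IsClosed K)
    {s t ε : ℝ} (hs : 0 ≤ s) (hst : s < t) (hε : 0 < ε)
    (hKt : packMeasure T (zeroPotential X) t ε K ≠ 0) :
    ∃ μ : Measure (X 0), (IsProbabilityMeasure μ ∧ μ K = 1) ∧ (s : EReal) ≤ upperEnt μ T := by
  set P := packOuter T (zeroPotential X) t ε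
  have hKP : P K ≠ 0 := hKt
  let C : Set (X 0) := {x ∈ K | ∀ u ∈ 𝓝[K] x, 0 < P u}
  have hnull : P (K \ C) = 0 := by
    refine measure_null_of_locally_null _ fun x hx => ?_
    have hx2 : ¬ ∀ u ∈ 𝓝[K] x, 0 < P u := fun h => hx.2 ⟨hx.1, h⟩
    push Not at hx2
    obtain ⟨u, hu, hPu⟩ := hx2
    exact ⟨u, nhdsWithin_mono x sdiff_subset hu, le_antisymm hPu bot_le⟩
  have hCpos : ∀ x ∈ C, ∀ r > 0, P (C ∩ Metric.ball x r) ≠ 0 := by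
    intro x hx r hr h0
    refine (hx.2 (K ∩ Metric.ball x r)
      (inter_mem_nhdsWithin _ (Metric.ball_mem_nhds x hr))).ne' ?_
    refine measure_mono_null (t := (C ∩ Metric.ball x r) ∪ (K \ C)) ?_
      (measure_union_null h0 hnull)
    intro y hy
    by_cases hyC : y ∈ C
    · exact Or.inl ⟨hyC, hy.2⟩
    · exact Or.inr ⟨hy.1, hyC⟩
  have hCne : C.Nonempty := by
    rw [nonempty_iff_ne_empty]
    intro h
    rw [h, sdiff_empty] at hnull
    exact hKP hnull
  obtain ⟨x₀, hx₀⟩ := hCne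
  have hpack : ∀ x ∈ C, ∀ r > 0, ∀ N, ∃ D : Finset (X 0 × ℕ),
      IsPacking T N ε (C ∩ Metric.ball x r) (D : Set (X 0 × ℕ)) ∧
        1 ≤ ∑ p ∈ D, ENNReal.ofReal (Real.exp (-(p.2 : ℝ) * s)) :=
    fun x hx r hr N => exists_finset_packing hst (hCpos x hx r hr) N
  choose next hnext_ord hnext using fun (S : PackingStage T C s ε) (N : ℕ) =>
    S.exists_refines hT hpack hε.le N
  let S : ℕ → PackingStage T C s ε := fun n =>
    Nat.rec (PackingStage.single x₀ hx₀ s ε) (fun k R => next R (k + 1)) n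
  have hord : ∀ n, ∀ i, n ≤ (S n).ord i
    | 0, _ => Nat.zero_le _
    | k + 1, i => hnext_ord (S k) (k + 1) i
  obtain ⟨μ, hμ⟩ := IsCompact.nonempty_iInter_of_sequence_nonempty_isCompact_isClosed
    (fun n => (S n).measures K) (fun n => (hnext (S n) (n + 1)).measures_subset hε.le hK)
    (fun n => (S n).nonempty_measures fun x hx => hx.1)
    ((S 0).isClosed_measures hK).isCompact (fun n => (S n).isClosed_measures hK)
  rw [mem_iInter] at hμ
  have hae : ∀ᵐ x ∂(μ : Measure (X 0)), ∀ n, ∃ i, x ∈ (S n).cell K i :=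
    ae_all_iff.2 fun n => (S n).ae_mem_cell hε.le hK (hμ n)
  refine ⟨μ, ⟨inferInstance, ?_⟩, le_upperEnt hs ?_⟩
  · refine (prob_compl_eq_zero_iff hK.measurableSet).1 (measure_eq_zero_iff_ae_notMem.2 ?_)
    filter_upwards [hae] with x hx
    obtain ⟨i, hi⟩ := hx 0
    exact not_not.2 hi.2
  · filter_upwards [hae] with x hx
    refine le_localUpperEnt_of_frequently hε (frequently_atTop.2 fun n => ?_)
    obtain ⟨i, hi⟩ := hx n
    exact ⟨_, hord n i, (S n).measure_bowenBall_le hε.le hK (hμ n) hi⟩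

lemma packEnt_le_iSup_upperEnt (hT : ∀ k, Continuous (T k)) {K : Set (X 0)} (hK : IsClosed K)
    (hKne : K.Nonempty) :
    packEnt T K ≤ ⨆ (μ : Measure (X 0)) (_ : IsProbabilityMeasure μ ∧ μ K = 1), upperEnt μ T := by
  refine le_of_forall_lt fun c hc => ?_
  obtain ⟨s, hcs, hs⟩ := EReal.lt_iff_exists_real_btwn.1 hc
  suffices h : ∃ μ : Measure (X 0), (IsProbabilityMeasure μ ∧ μ K = 1) ∧
      (s : EReal) ≤ upperEnt μ T by
    obtain ⟨μ, hμ, hle⟩ := h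
    exact hcs.trans_le (le_iSup₂_of_le μ hμ hle)
  rcases le_total s 0 with hs0 | hs0
  · obtain ⟨x, hx⟩ := hKne
    refine ⟨Measure.dirac x, ⟨inferInstance, Measure.dirac_apply_of_mem hx⟩, ?_⟩
    refine (EReal.coe_le_coe_iff.2 hs0).trans (le_upperEnt le_rfl (Eventually.of_forall ?_))
    exact localUpperEnt_nonneg
  · simp only [packEnt, packP, lt_iSup_iff] at hs
    obtain ⟨ε, hε, hs⟩ := hs
    obtain ⟨t, hst, ht⟩ := EReal.lt_iff_exists_real_btwn.1 hs
    exact exists_measure_le_upperEnt hT hK hs0 (by exact_mod_cast hst) hε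
      fun h0 => ht.not_ge (iInf₂_le t h0)

end LowerBound

end Metric

end NDS

open NDS in
/-- Variational principle for the packing entropy.
For a non-empty compact `K ⊆ X 0`,
`h^P(T,K) = sup { h̄_μ(T) : μ Borel probability measure on X 0 with μ(K) = 1 }`. -/
theorem stmt6 {X : ℕ → Type*} [∀ k, MetricSpace (X k)] [∀ k, CompactSpace (X k)]
    [MeasurableSpace (X 0)] [BorelSpace (X 0)]
    (T : ∀ k, X k → X (k + 1)) (hT : ∀ k, Continuous (T k))
    (K : Set (X 0)) (hK : IsCompact K) (hKne : K.Nonempty) :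
    packEnt T K =
      ⨆ (μ : MeasureTheory.Measure (X 0))
        (_ : MeasureTheory.IsProbabilityMeasure μ ∧ μ K = 1), upperEnt μ T := by
  have hKc := hK.isClosed
  refine le_antisymm (packEnt_le_iSup_upperEnt hT hKc hKne) (iSup₂_le fun μ ⟨hμ, hμK⟩ => ?_)
  refine upperEnt_le_packEnt hT (measure_eq_zero_iff_ae_notMem.1
    ((prob_compl_eq_zero_iff hKc.measurableSet).2 hμK) |>.mono fun x hx => not_not.1 hx)
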